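/- (Main Theorem) Let q be a prime power and r > 1 any integer with q ≡ 1 (mod r). Let c ≠ 0 be an r-th power residue in F_q, and let b ∈ F_q satisfy (b^r - c)^((q-1)/p) ≠ 1 for every prime divisor p of r. Let θ ∈ F_{q^r} satisfy θ^r = b^r - c, and set α = b - θ. Then x = α · (∏_{i=1}^{r-1} α^(1 + q + q^2 + ... + q^(i-1)))^((q-1)/r) lies in (the image of) F_q and satisfies x^r = c. -/

import Mathlib

/-- In an extension `K` of a finite field `F`, the fixed points of the Frobenius lie in `F`. -/
theorem mem_range_algebraMap_of_pow_card_eq_self {F K : Type*} [Field F] [Field K] [Fintype F]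
    [Algebra F K] {x : K} (hx : x ^ Fintype.card F = x) : x ∈ Set.range (algebraMap F K) := by
  have hq : 1 < Fintype.card F := Fintype.one_lt_card
  have hmonic : (Polynomial.X ^ Fintype.card F - Polynomial.X : Polynomial F).Monic :=
    Polynomial.monic_X_pow_sub (by simpa using hq)
  have hprod := Polynomial.prod_multiset_X_sub_C_of_monic_of_roots_card_eq hmonic (by
    rw [FiniteField.roots_X_pow_card_sub_X, FiniteField.X_pow_card_sub_X_natDegree_eq F hq]
    rfl)
  rw [FiniteField.roots_X_pow_card_sub_X] at hprod
  have h : ∏ a : F, (x - algebraMap F K a) = 0 := by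
    have := congrArg (Polynomial.aeval x)
      (show ∏ a : F, (Polynomial.X - Polynomial.C a) = _ from hprod)
    simpa [hx, map_prod] using this
  obtain ⟨a, -, ha⟩ := Finset.prod_eq_zero_iff.mp h
  exact ⟨a, (sub_eq_zero.mp ha).symm⟩

theorem IsPrimitiveRoot.prod_range_sub_pow_mul {R : Type*} [CommRing R] [IsDomain R] {n : ℕ}
    {ζ : R} (hζ : IsPrimitiveRoot ζ n) (hn : 0 < n) (x y : R) :
    ∏ i ∈ Finset.range n, (x - ζ ^ i * y) = x ^ n - y ^ n := by
  have := congrArg (Polynomial.eval x) (X_pow_sub_C_eq_prod hζ hn (rfl : y ^ n = y ^ n))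
  simpa [Polynomial.eval_prod] using this.symm

theorem mul_prod_pow_geom_sum_pow {M : Type*} [CommMonoid M] (a : M) {q r : ℕ} (hq : 1 ≤ q)
    (hr : 1 ≤ r) (hrq : r ∣ q - 1) :
    (a * (∏ i ∈ Finset.Icc 1 (r - 1), a ^ ∑ j ∈ Finset.range i, q ^ j) ^ ((q - 1) / r)) ^ r =
      ∏ i ∈ Finset.range r, a ^ q ^ i := by
  obtain ⟨n, rfl⟩ : ∃ n, r = n + 1 := ⟨r - 1, by omega⟩
  obtain ⟨m, rfl⟩ : ∃ m, q = m + 1 := ⟨q - 1, by omega⟩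
  rw [mul_pow, ← pow_mul, Nat.div_mul_cancel hrq, Finset.prod_range_succ', Finset.range_eq_Ico,
    Finset.prod_Ico_add' (fun i => a ^ (m + 1) ^ i) 0 n 1, pow_succ]
  have h : a ^ n = ∏ _i ∈ Finset.Icc 1 n, a := by simp
  simp only [Nat.add_sub_cancel, zero_add, Finset.Ico_add_one_right_eq_Icc, pow_zero, pow_one]
  rw [mul_right_comm, h, ← Finset.prod_pow, ← Finset.prod_mul_distrib]
  congr 1
  refine Finset.prod_congr rfl fun i _ => ?_
  rw [← pow_mul, ← pow_succ', geom_sum_mul_add]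

/-- The norm of `b - θ`, as the product of its Frobenius conjugates, for a Kummer generator `θ`
(or `θ = 0`). -/
theorem prod_range_sub_pow_card_pow {F K : Type*} [Field F] [Field K] [Fintype F] [Algebra F K]
    {r : ℕ} (hr : 0 < r) (hrq : r ∣ Fintype.card F - 1) {a b : F} {θ : K}
    (ha : ∀ p : ℕ, p.Prime → p ∣ r → a ^ ((Fintype.card F - 1) / p) ≠ 1)
    (hθ : θ ^ r = algebraMap F K a) :
    ∏ i ∈ Finset.range r, (algebraMap F K b - θ) ^ Fintype.card F ^ i =
      algebraMap F K (b ^ r - a) := by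
  set q := Fintype.card F
  have hq1 : 1 < q := Fintype.one_lt_card
  obtain ⟨k, hk⟩ := hrq
  have hconj (i : ℕ) : (algebraMap F K b - θ) ^ q ^ i = algebraMap F K b - θ ^ q ^ i := by
    have h := map_sub (FiniteField.frobeniusAlgHom F K ^ i) (algebraMap F K b) θ
    rw [AlgHom.commutes] at h
    simpa only [AlgHom.coe_pow, FiniteField.coe_frobeniusAlgHom, pow_iterate] using h
  simp only [hconj, map_sub, map_pow]
  rcases eq_or_ne a 0 with rfl | ha0
  · have hθ0 : θ = 0 := by simpa [hr.ne'] using hθ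
    have h (i : ℕ) : (0 : K) ^ q ^ i = 0 := zero_pow (pow_ne_zero i (by omega))
    simp [hθ0, h]
  · have hprim : IsPrimitiveRoot (a ^ k) r := by
      rw [IsPrimitiveRoot.iff_orderOf]
      refine orderOf_eq_of_pow_and_pow_div_prime hr ?_ fun p hp hpr => ?_
      · rw [← pow_mul, mul_comm, ← hk, FiniteField.pow_card_sub_one_eq_one a ha0]
      · rw [← pow_mul, ← Nat.mul_div_assoc _ hpr, mul_comm, ← hk]
        exact ha p hp hpr
    have hprimK := hprim.map_of_injective (algebraMap F K).injective
    have hθq : θ ^ q = algebraMap F K (a ^ k) * θ := by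
      rw [show q = r * k + 1 by omega, pow_succ, pow_mul, hθ, map_pow]
    have hθpow (i : ℕ) : θ ^ q ^ i = algebraMap F K (a ^ k) ^ i * θ := by
      induction i with
      | zero => simp
      | succ i ih =>
        rw [pow_succ, pow_mul, ih, mul_pow, hθq, ← map_pow, ← map_pow, FiniteField.pow_card,
          map_pow]
        ring
    simp only [hθpow, hprimK.prod_range_sub_pow_mul hr, hθ]

/-- Main Theorem: for any `r > 1` with `q ≡ 1 (mod r)`, if
`(b^r - c)^((q-1)/p) ≠ 1` for every prime `p ∣ r`, then
`x = α · (∏_{i=1}^{r-1} α^(1+q+⋯+q^(i-1)))^((q-1)/r)` lies in `F_q` and `x^r = c`. -/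
theorem new_rth_root_algorithm
    (F K : Type*) [Field F] [Field K] [Fintype F] [Fintype K] [Algebra F K]
    (q r : ℕ) (hq : q = Fintype.card F) (hK : Fintype.card K = q ^ r)
    (hr : 1 < r) (hqr : q ≡ 1 [MOD r])
    (c : F) (hc0 : c ≠ 0) (hc : ∃ x : F, x ^ r = c)
    (b : F) (hb : ∀ p : ℕ, p.Prime → p ∣ r → (b ^ r - c) ^ ((q - 1) / p) ≠ 1)
    (θ : K) (hθ : θ ^ r = algebraMap F K (b ^ r - c)) :
    (algebraMap F K b - θ) *
        (∏ i ∈ Finset.Icc 1 (r - 1),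
          (algebraMap F K b - θ) ^ (∑ j ∈ Finset.range i, q ^ j)) ^ ((q - 1) / r)
      ∈ Set.range (algebraMap F K) ∧
    ((algebraMap F K b - θ) *
        (∏ i ∈ Finset.Icc 1 (r - 1),
          (algebraMap F K b - θ) ^ (∑ j ∈ Finset.range i, q ^ j)) ^ ((q - 1) / r)) ^ r
      = algebraMap F K c := by
  subst hq
  have hq1 : 1 < Fintype.card F := Fintype.one_lt_card
  have hrq : r ∣ Fintype.card F - 1 := (Nat.modEq_iff_dvd' hq1.le).mp hqr.symm
  set x := (algebraMap F K b - θ) *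
    (∏ i ∈ Finset.Icc 1 (r - 1),
      (algebraMap F K b - θ) ^ (∑ j ∈ Finset.range i, Fintype.card F ^ j)) ^
        ((Fintype.card F - 1) / r) with hx
  have hxr : x ^ r = algebraMap F K c := by
    rw [hx, mul_prod_pow_geom_sum_pow _ hq1.le hr.le hrq,
      prod_range_sub_pow_card_pow (by omega) hrq hb hθ, sub_sub_cancel]
  refine ⟨mem_range_algebraMap_of_pow_card_eq_self ?_, hxr⟩
  obtain ⟨y, rfl⟩ := hc
  have hy : y ≠ 0 := by
    rintro rfl
    exact hc0 (zero_pow (by omega))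
  have hx1 : x ^ (Fintype.card F - 1) = 1 := by
    obtain ⟨k, hk⟩ := hrq
    rw [hk, pow_mul, hxr, ← map_pow, ← pow_mul, ← hk, FiniteField.pow_card_sub_one_eq_one y hy,
      map_one]
  rw [← Nat.sub_add_cancel hq1.le, pow_succ, hx1, one_mul]
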